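/- Let M, N, K be positive integers, A ∈ ℝ^{M×N}, P ∈ ℝ^{M×K}, Q ∈ ℝ^{K×N}, and θ > 0. Set c₁ = 3 and c₂ = ‖A‖_F, and define F(U,Z) = θ(‖U‖₁ + ‖Z‖₁) + ⟨P,U⟩_F + ⟨Q,Z⟩_F + c₁·((‖U‖_F² + ‖Z‖_F²)/2)² + c₂·(‖U‖_F² + ‖Z‖_F²)/2 on ℝ^{M×K} × ℝ^{K×N}. If r ≥ 0 satisfies c₁(‖S_θ(−P)‖_F² + ‖S_θ(−Q)‖_F²)·r³ + c₂·r − 1 = 0, then (U*, Z*) = (r·S_θ(−P), r·S_θ(−Q)) is a global minimizer of F. -/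

import Mathlib

/-- Frobenius inner product of real matrices. -/
noncomputable def fip {m n : ℕ} (X Y : Matrix (Fin m) (Fin n) ℝ) : ℝ :=
  ∑ i, ∑ j, X i j * Y i j

/-- Frobenius norm of a real matrix. -/
noncomputable def fnorm {m n : ℕ} (X : Matrix (Fin m) (Fin n) ℝ) : ℝ :=
  Real.sqrt (fip X X)

/-- Entrywise ℓ1 norm of a real matrix. -/
noncomputable def l1 {m n : ℕ} (X : Matrix (Fin m) (Fin n) ℝ) : ℝ :=
  ∑ i, ∑ j, |X i j|

/-- Entrywise soft-thresholding operator. -/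
noncomputable def soft {m n : ℕ} (θ : ℝ) (Y : Matrix (Fin m) (Fin n) ℝ) :
    Matrix (Fin m) (Fin n) ℝ :=
  fun i j => max (|Y i j| - θ) 0 * Real.sign (Y i j)

theorem fnorm_sq {m n : ℕ} (X : Matrix (Fin m) (Fin n) ℝ) : fnorm X ^ 2 = fip X X :=
  Real.sq_sqrt (Finset.sum_nonneg fun _ _ => Finset.sum_nonneg fun _ _ => mul_self_nonneg _)

theorem fip_smul_smul {m n : ℕ} (r : ℝ) (X : Matrix (Fin m) (Fin n) ℝ) :
    fip (r • X) (r • X) = r ^ 2 * fip X X := by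
  simp only [fip, Finset.mul_sum, Matrix.smul_apply, smul_eq_mul]
  exact Finset.sum_congr rfl fun _ _ => Finset.sum_congr rfl fun _ _ => by ring

/-- The residual of soft-thresholding has absolute value at most the threshold. -/
theorem neg_soft_mul_le {θ : ℝ} (hθ : 0 < θ) (p u : ℝ) :
    -(max (|-p| - θ) 0 * Real.sign (-p) * u) ≤ θ * |u| + p * u := by
  have hu := le_abs_self u
  have hu' := neg_abs_le u
  rcases lt_trichotomy p 0 with hp | rfl | hp
  · rw [Real.sign_of_pos (neg_pos.2 hp), abs_of_pos (neg_pos.2 hp)]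
    rcases max_cases (-p - θ) 0 with ⟨h, h'⟩ | ⟨h, h'⟩ <;> rw [h]
    · nlinarith
    · nlinarith [abs_nonneg u]
  · simp; positivity
  · rw [Real.sign_of_neg (neg_lt_zero.2 hp), abs_of_neg (neg_lt_zero.2 hp)]
    rcases max_cases (- -p - θ) 0 with ⟨h, h'⟩ | ⟨h, h'⟩ <;> rw [h]
    · nlinarith
    · nlinarith [abs_nonneg u]

/-- Soft-thresholding attains equality in `neg_soft_mul_le`. -/
theorem soft_abs_add_mul (θ p : ℝ) :
    θ * |max (|-p| - θ) 0 * Real.sign (-p)| + p * (max (|-p| - θ) 0 * Real.sign (-p)) =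
      -(max (|-p| - θ) 0 * Real.sign (-p)) ^ 2 := by
  rw [abs_mul, abs_of_nonneg (le_max_right (|-p| - θ) 0)]
  rcases lt_trichotomy p 0 with hp | rfl | hp
  · rw [Real.sign_of_pos (neg_pos.2 hp), abs_of_pos (neg_pos.2 hp)]
    rcases max_cases (-p - θ) 0 with ⟨h, h'⟩ | ⟨h, h'⟩ <;> rw [h]
    · simp; ring
    · simp
  · simp
  · rw [Real.sign_of_neg (neg_lt_zero.2 hp), abs_of_neg (neg_lt_zero.2 hp)]
    rcases max_cases (- -p - θ) 0 with ⟨h, h'⟩ | ⟨h, h'⟩ <;> rw [h]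
    · simp; ring
    · simp

theorem l1_add_fip_soft {m n : ℕ} (θ : ℝ) {r : ℝ} (hr : 0 ≤ r) (P : Matrix (Fin m) (Fin n) ℝ) :
    θ * l1 (r • soft θ (-P)) + fip P (r • soft θ (-P)) =
      -(r * fip (soft θ (-P)) (soft θ (-P))) := by
  simp only [l1, fip, Finset.mul_sum, ← Finset.sum_add_distrib, ← Finset.sum_neg_distrib]
  refine Finset.sum_congr rfl fun i _ => Finset.sum_congr rfl fun j _ => ?_
  simp only [soft, Matrix.smul_apply, Matrix.neg_apply, smul_eq_mul]
  rw [abs_mul r, abs_of_nonneg hr]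
  linear_combination r * soft_abs_add_mul θ (P i j)

theorem le_l1_add_fip {m n : ℕ} {θ r q : ℝ} (hθ : 0 < θ) (hr : 0 < r) (hrq : r * q = 1)
    (P U : Matrix (Fin m) (Fin n) ℝ) :
    -(r / 2 * fip (soft θ (-P)) (soft θ (-P)) + q / 2 * fip U U) ≤ θ * l1 U + fip P U := by
  simp only [l1, fip, Finset.mul_sum, ← Finset.sum_add_distrib, ← Finset.sum_neg_distrib]
  refine Finset.sum_le_sum fun i _ => Finset.sum_le_sum fun j _ => ?_
  refine le_trans ?_ (neg_soft_mul_le hθ (P i j) (U i j))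
  simp only [soft, Matrix.neg_apply]
  set s := max (|-P i j| - θ) 0 * Real.sign (-P i j)
  have hq : 0 < q := pos_of_mul_pos_right (hrq ▸ one_pos) hr.le
  have key : r * s ^ 2 + q * U i j ^ 2 - 2 * (s * U i j) = q * (r * s - U i j) ^ 2 := by
    linear_combination (2 * s * U i j - r * s ^ 2) * hrq
  have := mul_nonneg hq.le (sq_nonneg (r * s - U i j))
  linarith

/-- if r ≥ 0 solves 3(‖S_θ(−P)‖²+‖S_θ(−Q)‖²)r³ + ‖A‖_F r − 1 = 0, then
(U*,Z*) = (r·S_θ(−P), r·S_θ(−Q)) globally minimizes the ℓ1-regularized BPG subproblem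
F(U,Z) = θ(‖U‖₁+‖Z‖₁) + ⟨P,U⟩ + ⟨Q,Z⟩ + 3((‖U‖²+‖Z‖²)/2)² + ‖A‖_F(‖U‖²+‖Z‖²)/2. -/
theorem stmt13 (M N K : ℕ) (hM : 0 < M) (hN : 0 < N) (hK : 0 < K)
    (A : Matrix (Fin M) (Fin N) ℝ)
    (P : Matrix (Fin M) (Fin K) ℝ) (Q : Matrix (Fin K) (Fin N) ℝ)
    (θ : ℝ) (hθ : 0 < θ) (r : ℝ) (hr : 0 ≤ r)
    (hcubic : 3 * (fnorm (soft θ (-P)) ^ 2 + fnorm (soft θ (-Q)) ^ 2) * r ^ 3 +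
      fnorm A * r - 1 = 0) :
    ∀ (U : Matrix (Fin M) (Fin K) ℝ) (Z : Matrix (Fin K) (Fin N) ℝ),
      θ * (l1 (r • soft θ (-P)) + l1 (r • soft θ (-Q))) +
          fip P (r • soft θ (-P)) + fip Q (r • soft θ (-Q)) +
          3 * ((fnorm (r • soft θ (-P)) ^ 2 + fnorm (r • soft θ (-Q)) ^ 2) / 2) ^ 2 +
          fnorm A * ((fnorm (r • soft θ (-P)) ^ 2 + fnorm (r • soft θ (-Q)) ^ 2) / 2) ≤
        θ * (l1 U + l1 Z) + fip P U + fip Q Z +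
          3 * ((fnorm U ^ 2 + fnorm Z ^ 2) / 2) ^ 2 +
          fnorm A * ((fnorm U ^ 2 + fnorm Z ^ 2) / 2) := by
  intro U Z
  have hr0 : 0 < r := hr.lt_of_ne (by rintro rfl; simp at hcubic)
  simp only [fnorm_sq (soft _ _), fnorm_sq (_ • _), fnorm_sq U, fnorm_sq Z,
    fip_smul_smul] at hcubic ⊢
  have hP := l1_add_fip_soft θ hr P
  have hQ := l1_add_fip_soft θ hr Q
  set a := fip (soft θ (-P)) (soft θ (-P))
  set b := fip (soft θ (-Q)) (soft θ (-Q))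
  have hrq : r * (3 * (a + b) * r ^ 2 + fnorm A) = 1 := by linear_combination hcubic
  have hU := le_l1_add_fip hθ hr0 hrq P U
  have hZ := le_l1_add_fip hθ hr0 hrq Q Z
  have hsq := sq_nonneg (fip U U + fip Z Z - r ^ 2 * (a + b))
  have hlin : fnorm A * r ^ 2 * (a + b) = r * (a + b) - 3 * r ^ 4 * (a + b) ^ 2 := by
    linear_combination r * (a + b) * hcubic
  linarith
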